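/- (Iteration step) Define g ∘ h = g · q(g) · h · q(g)⁻¹ · β(g,h), let x̄ denote the inverse of x with respect to ∘, and define g ∗ h = ((((g ∘ f(g)) ∘ h) ∘ (f(g))‾) ∘ α(g,h)). Then for all g, h ∈ G, g ∗ h = g · r(g) · h · r(g)⁻¹ · γ(g,h), where r(g) = q(g) · f(g) · q(f(g)) and γ(g,h) = [f(g), q(h)] · β(f(g), h) · β(h, f(g)⁻¹) · β(g,h) · α(g,h), with [x,y] = x·y·x⁻¹·y⁻¹. Moreover r is a lifting of the endomorphism θ + ψ + θψ of G/K given by xK ↦ θ(xK)·ψ(xK)·θ(ψ(xK)), i.e. r(g)K = θ(gK)·ψ(gK)·θ(ψ(gK)) for all g ∈ G. -/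

import Mathlib

/-- Elements that agree modulo a central subgroup act identically by conjugation. -/
theorem conj_eq_conj_of_mk_eq {G : Type*} [Group G] {K : Subgroup G}
    (hKZ : K ≤ Subgroup.center G) {x y : G}
    (hxy : (QuotientGroup.mk x : G ⧸ K) = QuotientGroup.mk y) (t : G) :
    x * t * x⁻¹ = y * t * y⁻¹ := by
  have hc := Subgroup.mem_center_iff.1 (hKZ (QuotientGroup.eq.1 hxy)) t
  calc x * t * x⁻¹ = x * (t * (x⁻¹ * y)) * y⁻¹ := by group
    _ = y * t * y⁻¹ := by rw [hc]; group

/-- If `⁅x, y⁆` is central then `⁅y, x⁻¹⁆ = ⁅x, y⁆`. -/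
theorem mul_inv_mul_inv_mul_eq_of_mem_center {G : Type*} [Group G] {x y : G}
    (h : x * y * x⁻¹ * y⁻¹ ∈ Subgroup.center G) :
    y * x⁻¹ * y⁻¹ * x = x * y * x⁻¹ * y⁻¹ := by
  have hc := Subgroup.mem_center_iff.1 h x
  calc y * x⁻¹ * y⁻¹ * x = x⁻¹ * ((x * y * x⁻¹ * y⁻¹) * x) := by group
    _ = x * y * x⁻¹ * y⁻¹ := by rw [← hc]; group

/-- Conjugating `b⁻¹ * x⁻¹ * b` by `c` contributes the commutator of `x` and `c` when the
relevant commutators are central. -/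
theorem conj_inv_conj_of_mem_center {G : Type*} [Group G] {x b c : G}
    (hb : b⁻¹ * x⁻¹ * b * x ∈ Subgroup.center G)
    (hc : x * c * x⁻¹ * c⁻¹ ∈ Subgroup.center G) :
    c * (b⁻¹ * x⁻¹ * b) * c⁻¹ = b⁻¹ * x⁻¹ * b * (x * c * x⁻¹ * c⁻¹) := by
  have hz := Subgroup.mem_center_iff.1 hb c
  rw [← mul_inv_mul_inv_mul_eq_of_mem_center hc]
  calc c * (b⁻¹ * x⁻¹ * b) * c⁻¹ = c * (b⁻¹ * x⁻¹ * b * x) * x⁻¹ * c⁻¹ := by group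
    _ = b⁻¹ * x⁻¹ * b * x * (c * x⁻¹ * c⁻¹ * x) * x⁻¹ := by rw [hz]; group
    _ = b⁻¹ * x⁻¹ * b * (x * (c * x⁻¹ * c⁻¹ * x)) * x⁻¹ := by group
    _ = b⁻¹ * x⁻¹ * b * (c * x⁻¹ * c⁻¹ * x) := by
      rw [Subgroup.mem_center_iff.1
        (mul_inv_mul_inv_mul_eq_of_mem_center hc ▸ hc) x]
      group

/-- The central factors in the iterated product cancel to the expected ones. -/
theorem central_factors_cancel {C : Type*} [Group C] [IsMulCommutative C] (e p r s t u v : C) :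
    p * (r * s) * t * (p⁻¹ * t⁻¹ * u) * e * v = e * s * u * r * v := by
  open scoped IsMulCommutative in
  apply Additive.ofMul.injective
  simp only [ofMul_mul, ofMul_inv]
  abel

/-- Iteration step: iterating the construction yields an operation of the same form,
whose lifting is `q + f + qf` and whose bilinear map is the stated `γ`. -/
theorem stmt_9
    {G : Type*} [Group G] (K A : Subgroup G) [K.Normal]
    (hKZ : K ≤ Subgroup.center G) (hKA : K ≤ A)
    (hAK : ∀ a ∈ A, ∀ b ∈ A, a * b * a⁻¹ * b⁻¹ ∈ K)
    (θ : G ⧸ K →* G ⧸ K)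
    (hθA : ∀ x : G ⧸ K, θ x ∈ Subgroup.map (QuotientGroup.mk' K) A)
    (q : G → G) (hqA : ∀ g, q g ∈ A)
    (hq : ∀ g : G, (QuotientGroup.mk (q g) : G ⧸ K) = θ (QuotientGroup.mk g))
    (ψ : G ⧸ K →* G ⧸ K)
    (hψA : ∀ x : G ⧸ K, ψ x ∈ Subgroup.map (QuotientGroup.mk' K) A)
    (f : G → G) (hfA : ∀ g, f g ∈ A)
    (hf : ∀ g : G, (QuotientGroup.mk (f g) : G ⧸ K) = ψ (QuotientGroup.mk g))
    (β : G → G → G) (hβK : ∀ g h, β g h ∈ K)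
    (hβmul₁ : ∀ g h k : G, β (g * h) k = β g k * β h k)
    (hβmul₂ : ∀ g h k : G, β g (h * k) = β g h * β g k)
    (hβK₁ : ∀ g : G, ∀ k ∈ K, β k g = 1)
    (hβK₂ : ∀ g : G, ∀ k ∈ K, β g k = 1)
    (α : G → G → G) (hαK : ∀ g h, α g h ∈ K)
    (hαmul₁ : ∀ g h k : G, α (g * h) k = α g k * α h k)
    (hαmul₂ : ∀ g h k : G, α g (h * k) = α g h * α g k)
    (hαK₁ : ∀ g : G, ∀ k ∈ K, α k g = 1)
    (hαK₂ : ∀ g : G, ∀ k ∈ K, α g k = 1)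
    (circ : G → G → G)
    (hcirc : ∀ g h : G, circ g h = g * q g * h * (q g)⁻¹ * β g h)
    (bar : G → G)
    (hbar : ∀ x : G, circ x (bar x) = 1 ∧ circ (bar x) x = 1)
    (star : G → G → G)
    (hstar : ∀ g h : G,
      star g h = circ (circ (circ (circ g (f g)) h) (bar (f g))) (α g h)) :
    (∀ g h : G,
      star g h =
        g * (q g * f g * q (f g)) * h * (q g * f g * q (f g))⁻¹ *
          (f g * q h * (f g)⁻¹ * (q h)⁻¹ * β (f g) h * β h ((f g)⁻¹) * β g h * α g h)) ∧
    (∀ g : G,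
      (QuotientGroup.mk (q g * f g * q (f g)) : G ⧸ K) =
        θ (QuotientGroup.mk g) * ψ (QuotientGroup.mk g) * θ (ψ (QuotientGroup.mk g))) := by
  have comm : ∀ {z : G}, z ∈ K → ∀ x, x * z = z * x := fun hz x =>
    Subgroup.mem_center_iff.1 (hKZ hz) x
  have βinv₁ : ∀ x y, β x⁻¹ y = (β x y)⁻¹ := fun x y =>
    eq_inv_of_mul_eq_one_left (by rw [← hβmul₁, inv_mul_cancel, hβK₁ y 1 K.one_mem])
  have βinv₂ : ∀ x y, β x y⁻¹ = (β x y)⁻¹ := fun x y =>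
    eq_inv_of_mul_eq_one_left (by rw [← hβmul₂, inv_mul_cancel, hβK₂ x 1 K.one_mem])
  have circ_conj : ∀ {x s : G}, (QuotientGroup.mk (q x) : G ⧸ K) = QuotientGroup.mk s →
      ∀ y, circ x y = x * (s * y * s⁻¹) * β x y := fun hs y => by
    rw [hcirc, ← conj_eq_conj_of_mk_eq hKZ hs y]
    group
  have θcomm : ∀ x y : G, θ (QuotientGroup.mk x) * θ (QuotientGroup.mk y) =
      θ (QuotientGroup.mk y) * θ (QuotientGroup.mk x) := fun x y => by
    rw [← hq, ← hq, ← QuotientGroup.mk_mul, ← QuotientGroup.mk_mul, eq_comm,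
      QuotientGroup.eq]
    simpa [mul_assoc] using
      hAK _ (A.inv_mem (hqA x)) _ (A.inv_mem (hqA y))
  have θcirc : ∀ x y : G, (QuotientGroup.mk (q (circ x y)) : G ⧸ K) =
      QuotientGroup.mk (q x * q y) := fun x y => by
    have hβ : (QuotientGroup.mk (β x y) : G ⧸ K) = 1 :=
      (QuotientGroup.eq_one_iff _).2 (hβK x y)
    rw [QuotientGroup.mk_mul, hq, hq x, hq y, hcirc]
    simp only [QuotientGroup.mk_mul, QuotientGroup.mk_inv, map_mul, map_inv, hβ, mul_one]
    rw [mul_assoc (θ _) (θ _) (θ _), θcomm (q x) y]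
    group
  have βcirc : ∀ x y z : G, β (circ x y) z = β x z * β y z := fun x y z => by
    rw [hcirc]
    simp only [hβmul₁, βinv₁, hβK₁ z _ (hβK x y), mul_one]
    rw [mul_assoc (β x z) (β (q x) z), ← comm (hβK (q x) z) (β y z)]
    group
  have βcirc₂ : ∀ x y z : G, β z (circ x y) = β z x * β z y := fun x y z => by
    rw [hcirc]
    simp only [hβmul₂, βinv₂, hβK₂ z _ (hβK x y), mul_one]
    rw [mul_assoc (β z x) (β z (q x)), ← comm (hβK z (q x)) (β z y)]
    group
  refine ⟨fun g h => ?_, fun g => ?_⟩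
  · have βbar : ∀ x, β x (bar (f g)) = (β x (f g))⁻¹ := fun x =>
      eq_inv_of_mul_eq_one_right (by
        rw [← βcirc₂, (hbar (f g)).1, hβK₂ x 1 K.one_mem])
    have bar_eq : bar (f g) = (q (f g))⁻¹ * (f g)⁻¹ * q (f g) * β (f g) (f g) := by
      have hinv := eq_inv_of_mul_eq_one_left ((hcirc _ _).symm.trans (hbar (f g)).1)
      rw [βbar, inv_inv] at hinv
      rw [mul_assoc, comm (hβK _ _), ← hinv]
      group
    have hu₁ := θcirc g (f g)
    have hu₂ : (QuotientGroup.mk (q (circ (circ g (f g)) h)) : G ⧸ K) =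
        QuotientGroup.mk (q g * q (f g) * q h) := by
      rw [θcirc, QuotientGroup.mk_mul, hu₁, ← QuotientGroup.mk_mul]
    have hconj := conj_inv_conj_of_mem_center (x := f g) (b := q (f g)) (c := q h)
      (hKZ (by simpa using hAK _ (A.inv_mem (hqA (f g))) _ (A.inv_mem (hfA g))))
      (hKZ (hAK _ (hfA g) _ (hqA h)))
    have hcentral := congrArg Subtype.val (central_factors_cancel
      (⟨_, hKZ (hAK _ (hfA g) _ (hqA h))⟩ : Subgroup.center G)
      ⟨_, hKZ (hβK g (f g))⟩ ⟨_, hKZ (hβK g h)⟩ ⟨_, hKZ (hβK (f g) h)⟩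
      ⟨_, hKZ (hβK (f g) (f g))⟩ ⟨_, hKZ (hβK h (f g)⁻¹)⟩ ⟨_, hKZ (hαK g h)⟩)
    simp only [Subgroup.coe_mul, Subgroup.coe_inv] at hcentral
    have hαcirc : ∀ x, circ x (α g h) = x * α g h := fun x => by
      rw [circ_conj rfl, hβK₂ x _ (hαK g h), comm (hαK g h) (q x)]
      group
    have collect : ∀ {p m t : G}, p ∈ K → m ∈ K → t ∈ K → ∀ X Y T B n v : G,
        X * p * Y * m * (T * (B * t) * T⁻¹) * n * v =
          X * Y * (T * B * T⁻¹) * (p * m * t * n * v) := by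
      intro p m t hp hm ht X Y T B n v
      calc X * p * Y * m * (T * (B * t) * T⁻¹) * n * v
          = X * (p * Y) * m * (T * B * (t * T⁻¹)) * n * v := by group
        _ = X * Y * (p * m * (T * B * T⁻¹)) * t * n * v := by
          rw [← comm hp, ← comm ht]; group
        _ = _ := by rw [← comm (K.mul_mem hp hm)]; group
    have he := hAK _ (hfA g) _ (hqA h)
    have hT : q g * q (f g) * q h * ((q (f g))⁻¹ * (f g)⁻¹ * q (f g)) *
        (q g * q (f g) * q h)⁻¹ =
        q g * (f g)⁻¹ * (q g)⁻¹ * (f g * q h * (f g)⁻¹ * (q h)⁻¹) := by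
      calc _ = q g * q (f g) * (q h * ((q (f g))⁻¹ * (f g)⁻¹ * q (f g)) * (q h)⁻¹) *
            (q (f g))⁻¹ * (q g)⁻¹ := by group
        _ = q g * (f g)⁻¹ * (q (f g) * (f g * q h * (f g)⁻¹ * (q h)⁻¹) *
            (q (f g))⁻¹ * (q g)⁻¹) := by rw [hconj]; group
        _ = _ := by rw [comm he (q (f g)), mul_inv_cancel_right, ← comm he]; group
    rw [hstar, hαcirc, circ_conj hu₂, βcirc, βcirc, βbar, βbar, βbar, circ_conj hu₁, βcirc,
      circ_conj rfl, bar_eq, ← hcentral,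
      collect (hβK _ _) (K.mul_mem (hβK _ _) (hβK _ _)) (hβK _ _), βinv₂, hT]
    generalize β g (f g) * (β g h * β (f g) h) * β (f g) (f g) *
      ((β g (f g))⁻¹ * (β (f g) (f g))⁻¹ * (β h (f g))⁻¹) = w
    rw [comm he w]
    group
  · rw [QuotientGroup.mk_mul, QuotientGroup.mk_mul, hq, hq, hf]
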